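/- Incompatibility of margin and smoothness when αβ > d (Remark 2.2). Let μ be a probability measure on ℝ^d possessing a Lebesgue density g with g(x) ≥ g_min > 0 for all x in a set A ⊆ ℝ^d. Let η : ℝ^d → [0,1] satisfy the Hölder condition |η(x) − η(x')| ≤ L‖x − x'‖^β for all x, x' ∈ ℝ^d, with 0 < β ≤ 1, L > 0. Suppose there exists a point x₀ and a radius r₀ > 0 with B(x₀, r₀) ⊆ A and η(x₀) = 1/2, and suppose the margin assumption holds: μ({x : |η(x) − 1/2| ≤ t}) ≤ C_α t^α for all t > 0, with α ≥ 0, C_α > 0. Then αβ ≤ d. Equivalently, if αβ > d, then η cannot equal 1/2 at any interior point of the region where the density is bounded below, so the regression function cannot cross 1/2 in the interior of the support. -/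

import Mathlib

noncomputable section

open MeasureTheory

open Filter Topology in
/-- If `c * r ^ a ≤ C * r ^ b` for all small `r > 0`, with `c > 0`, then `b ≤ a`. -/
theorem exponent_le_of_mul_rpow_le {a b c C r₀ : ℝ} (hc : 0 < c) (hr₀ : 0 < r₀)
    (h : ∀ r, 0 < r → r < r₀ → c * r ^ a ≤ C * r ^ b) : b ≤ a := by
  by_contra! hab
  have hlim : Tendsto (fun r : ℝ => C * r ^ (b - a)) (𝓝[>] 0) (𝓝 (C * 0)) := by
    have h0 := (Real.continuousAt_rpow_const 0 (b - a) (Or.inr (sub_pos.2 hab).le)).tendsto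
    rw [Real.zero_rpow (sub_pos.2 hab).ne'] at h0
    exact (h0.mono_left nhdsWithin_le_nhds).const_mul C
  have hge : ∀ᶠ r in 𝓝[>] (0 : ℝ), c ≤ C * r ^ (b - a) := by
    filter_upwards [Ioo_mem_nhdsGT hr₀] with r hr
    rw [Real.rpow_sub hr.1, ← mul_div_assoc, le_div_iff₀ (Real.rpow_pos_of_pos hr.1 a)]
    exact h r hr.1 hr.2
  have := ge_of_tendsto hlim hge
  linarith

/-- A density bounded below by `m` on a measurable set `s` gives mass at least `m * volume s`. -/
theorem ofReal_mul_le_withDensity {X : Type*} [MeasurableSpace X] {ν : Measure X} {g : X → ℝ}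
    {s : Set X} (hs : MeasurableSet s) {m : ℝ} (hm : ∀ x ∈ s, m ≤ g x) :
    ENNReal.ofReal m * ν s ≤ ν.withDensity (fun x => ENNReal.ofReal (g x)) s := by
  rw [withDensity_apply _ hs, ← setLIntegral_const]
  exact setLIntegral_mono' hs fun x hx => ENNReal.ofReal_le_ofReal (hm x hx)

/-- **Incompatibility of margin and smoothness when `αβ > d`** (Remark 2.2): if a probability
measure `μ` on `ℝ^d` has a Lebesgue density bounded below by `g_min > 0` on a set `A`, the
regression function `η` is `(β,L)`-Hölder, `η` equals `1/2` at a point `x₀` with a ball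
`B(x₀,r₀) ⊆ A`, and the margin assumption holds with parameters `(α, C_α)`, then `αβ ≤ d`. -/
theorem margin_smoothness_incompatibility
    (d : ℕ) (μ : Measure (EuclideanSpace ℝ (Fin d))) (hμ : IsProbabilityMeasure μ)
    (A : Set (EuclideanSpace ℝ (Fin d))) (gmin : ℝ) (hgmin : 0 < gmin)
    (g : EuclideanSpace ℝ (Fin d) → ℝ) (hg : Measurable g)
    (hdens : μ = volume.withDensity fun x => ENNReal.ofReal (g x))
    (hglb : ∀ x ∈ A, gmin ≤ g x)
    (η : EuclideanSpace ℝ (Fin d) → ℝ) (β L : ℝ) (hβ0 : 0 < β) (hβ1 : β ≤ 1) (hL : 0 < L)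
    (hHolder : ∀ x x', |η x - η x'| ≤ L * ‖x - x'‖ ^ β)
    (x₀ : EuclideanSpace ℝ (Fin d)) (r₀ : ℝ) (hr₀ : 0 < r₀)
    (hball : Metric.ball x₀ r₀ ⊆ A) (hx₀ : η x₀ = 1 / 2)
    (α Cα : ℝ) (hα : 0 ≤ α) (hCα : 0 < Cα)
    (hmargin : ∀ t : ℝ, 0 < t → (μ {x | |η x - 1 / 2| ≤ t}).toReal ≤ Cα * t ^ α) :
    α * β ≤ d := by
  set v := (volume (Metric.ball (0 : EuclideanSpace ℝ (Fin d)) 1)).toReal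
  have hvpos : 0 < v :=
    ENNReal.toReal_pos (Metric.measure_ball_pos volume _ one_pos).ne' measure_ball_lt_top.ne
  refine exponent_le_of_mul_rpow_le (c := gmin * v) (C := Cα * L ^ α) (mul_pos hgmin hvpos) hr₀
    fun r hr hrr₀ => ?_
  have hlower : gmin * (r ^ d * v) ≤ (μ (Metric.ball x₀ r)).toReal := by
    have h : ENNReal.ofReal gmin * volume (Metric.ball x₀ r) ≤ μ (Metric.ball x₀ r) := by
      rw [hdens]
      exact ofReal_mul_le_withDensity Metric.isOpen_ball.measurableSet
        fun x hx => hglb x (hball (Metric.ball_subset_ball hrr₀.le hx))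
    have h' := ENNReal.toReal_mono (measure_ne_top μ _) h
    rwa [Measure.addHaar_ball_of_pos _ _ hr, finrank_euclideanSpace_fin, ENNReal.toReal_mul,
      ENNReal.toReal_mul, ENNReal.toReal_ofReal hgmin.le,
      ENNReal.toReal_ofReal (pow_nonneg hr.le d)] at h'
  have hsub : Metric.ball x₀ r ⊆ {x | |η x - 1 / 2| ≤ L * r ^ β} := fun x hx => by
    rw [Metric.mem_ball, dist_eq_norm] at hx
    rw [Set.mem_ofPred_eq, ← hx₀]
    refine (hHolder x x₀).trans ?_
    gcongr
  have hupper := (ENNReal.toReal_mono (measure_ne_top μ _) (measure_mono hsub)).trans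
    (hmargin (L * r ^ β) (by positivity))
  rw [Real.mul_rpow hL.le (by positivity), ← Real.rpow_mul hr.le, mul_comm β α] at hupper
  rw [Real.rpow_natCast]
  linarith
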